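/- arXiv:2409.08559 — 3 statements merged into one kernel-verified Lean document; each statement's English description precedes it below -/
import Mathlib

section
/- Let F_q be a finite field with q elements, M_n the set of monic polynomials of degree n in F_q[t], and ω₁(f) the number of distinct monic irreducible factors of f appearing with multiplicity exactly 1. Then as n → ∞, Σ_{f ∈ M_n} ω₁(f) = q^n log n + q^n (A₁ - L(2)) + O(q^n/n), where A₁ = γ + Σ_{r≥1}(π_q(r) - q^r/r)q^{-r} and L(2) = Σ_{l ∈ P} |l|^{-2}, the sum over monic irreducible polynomials l. -/
open Filter Asymptotics Real Polynomial

/-- number of monic irreducible polynomials of degree r in F[t] -/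
noncomputable def piq (F : Type*) [Field F] [Fintype F] (r : ℕ) : ℕ :=
  Nat.card {l : Polynomial F // l.Monic ∧ Irreducible l ∧ l.natDegree = r}

/-- the constant A₁ = γ + Σ_{r≥1} (π_q(r) - q^r/r) q^{-r} -/
noncomputable def A1 (F : Type*) [Field F] [Fintype F] : ℝ :=
  Real.eulerMascheroniConstant +
    ∑' r : ℕ, if r = 0 then 0 else
      ((piq F r : ℝ) - (Fintype.card F : ℝ) ^ r / r) * ((Fintype.card F : ℝ) ^ r)⁻¹

/-- L(m) = Σ_{l ∈ P} |l|^{-m} -/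
noncomputable def Lc (F : Type*) [Field F] [Fintype F] (m : ℕ) : ℝ :=
  ∑' l : {l : Polynomial F // l.Monic ∧ Irreducible l},
    (((Fintype.card F : ℝ) ^ (l : Polynomial F).natDegree) ^ m)⁻¹

/-- ω_k(f): the number of distinct monic irreducible factors of f with multiplicity exactly k -/
noncomputable def omegak (F : Type*) [Field F] [Fintype F] (k : ℕ) (f : Polynomial F) : ℕ :=
  Nat.card {l : Polynomial F // l.Monic ∧ Irreducible l ∧ l ^ k ∣ f ∧ ¬ l ^ (k + 1) ∣ f}

section
variable (F : Type*) [Field F] [Fintype F]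

lemma card_MS (n : ℕ) : Nat.card {p : F[X] // p.Monic ∧ p.natDegree = n} = Fintype.card F ^ n := by
  rw [Nat.card_congr ((monicEquivDegreeLT n).trans (degreeLTEquiv F n).toEquiv)]
  simp

lemma finite_MS (n : ℕ) : {p : F[X] | p.Monic ∧ p.natDegree = n}.Finite := by
  have : Finite {p : F[X] // p.Monic ∧ p.natDegree = n} :=
    Finite.of_equiv _ ((monicEquivDegreeLT n).trans (degreeLTEquiv F n).toEquiv).symm
  exact this

/-- monic polynomials of degree n -/
noncomputable def MF (n : ℕ) : Finset F[X] := (finite_MS F n).toFinset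

lemma mem_MF {n : ℕ} {p : F[X]} : p ∈ MF F n ↔ p.Monic ∧ p.natDegree = n := by
  simp [MF]

lemma card_MF (n : ℕ) : (MF F n).card = Fintype.card F ^ n := by
  rw [← card_MS F n]
  exact (Nat.subtype_card _ (fun x => mem_MF F)).symm

open Classical in
/-- monic irreducibles of degree n -/
noncomputable def PF (n : ℕ) : Finset F[X] := (MF F n).filter Irreducible

lemma mem_PF {n : ℕ} {p : F[X]} : p ∈ PF F n ↔ p.Monic ∧ Irreducible p ∧ p.natDegree = n := by
  simp [PF, mem_MF]; tauto

lemma card_PF (n : ℕ) : (PF F n).card = piq F n := by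
  exact (Nat.subtype_card _ (fun x => mem_PF F)).symm

open Classical in
lemma count_dvd (n : ℕ) (g : F[X]) (hg : g.Monic) :
    ((MF F n).filter (g ∣ ·)).card = if g.natDegree ≤ n then Fintype.card F ^ (n - g.natDegree) else 0 := by
  split_ifs with h
  · rw [← card_MF F (n - g.natDegree)]
    symm
    apply Finset.card_bij (fun h _ => g * h)
    · intro a ha
      rw [mem_MF] at ha
      simp only [Finset.mem_filter, mem_MF, dvd_mul_right, and_true]
      refine ⟨hg.mul ha.1, ?_⟩
      rw [hg.natDegree_mul ha.1, ha.2]; omega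
    · intro a _ b _ hab
      exact mul_left_cancel₀ hg.ne_zero hab
    · rintro b hb
      simp only [Finset.mem_filter, mem_MF] at hb
      obtain ⟨⟨hb1, hb2⟩, c, rfl⟩ := hb
      have hc : c.Monic := hg.of_mul_monic_left hb1
      refine ⟨c, ?_, rfl⟩
      rw [mem_MF]
      refine ⟨hc, ?_⟩
      rw [hg.natDegree_mul hc] at hb2; omega
  · rw [Finset.card_eq_zero, Finset.filter_eq_empty_iff]
    intro b hb hd
    rw [mem_MF] at hb
    have := natDegree_le_of_dvd hd hb.1.ne_zero
    omega

open Classical in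
lemma prime_count (n : ℕ) (hn : n ≠ 0) :
    ∑ d ∈ n.divisors, d * piq F d = Fintype.card F ^ n := by
  set q := Fintype.card F with hq
  have hq1 : 1 < q := Fintype.one_lt_card
  have hne : (X ^ q ^ n - X : F[X]) ≠ 0 := FiniteField.X_pow_card_pow_sub_X_ne_zero F hn hq1
  have hmon : (X ^ q ^ n - X : F[X]).Monic := by
    apply monic_X_pow_sub
    rw [degree_X]
    exact_mod_cast Nat.one_lt_pow hn hq1
  have hprod : ∏ l ∈ n.divisors.biUnion (PF F), l = (X ^ q ^ n - X : F[X]) := by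
    apply eq_of_monic_of_associated (monic_prod_of_monic _ _ _) hmon
    · have hsq : Squarefree (X ^ q ^ n - X : F[X]) := by
        obtain ⟨p, hp⟩ := CharP.exists F
        have hpq : p ∣ q := (CharP.cast_eq_zero_iff F p q).1 (Nat.cast_card_eq_zero F)
        exact (galois_poly_separable p (q ^ n) (dvd_pow hpq hn)).squarefree
      have hval : (n.divisors.biUnion (PF F)).val =
          UniqueFactorizationMonoid.normalizedFactors (X ^ q ^ n - X : F[X]) := by
        rw [Multiset.Nodup.ext (Finset.nodup _)
          ((UniqueFactorizationMonoid.squarefree_iff_nodup_normalizedFactors hne).1 hsq)]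
        intro l
        rw [UniqueFactorizationMonoid.mem_normalizedFactors_iff' hne, Finset.mem_val,
          Finset.mem_biUnion]
        constructor
        · rintro ⟨d, hd, hl⟩
          rw [mem_PF] at hl
          obtain ⟨h1, h2, rfl⟩ := hl
          refine ⟨h2, h1.normalize_eq_self, ?_⟩
          have := (h2.natDegree_dvd_iff_dvd_X_pow_card_pow_sub_X (n := n)).1
            (Nat.dvd_of_mem_divisors hd)
          rwa [Nat.card_eq_fintype_card] at this
        · rintro ⟨h2, h1, h3⟩
          rw [hq, ← Nat.card_eq_fintype_card] at h3
          refine ⟨l.natDegree, Nat.mem_divisors.2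
            ⟨h2.natDegree_dvd_of_dvd_X_pow_card_pow_sub_X h3, hn⟩, ?_⟩
          rw [mem_PF]
          exact ⟨h1 ▸ monic_normalize h2.ne_zero, h2, rfl⟩
      have := UniqueFactorizationMonoid.prod_normalizedFactors hne
      rw [← hval] at this
      rwa [Finset.prod_val] at this
    · simp [mem_PF]; tauto
  rw [← FiniteField.X_pow_card_pow_sub_X_natDegree_eq F hn hq1, ← hprod,
    natDegree_prod_of_monic, Finset.sum_biUnion]
  · apply Finset.sum_congr rfl
    intro d hd
    rw [Finset.sum_congr rfl (g := fun _ => d), Finset.sum_const, card_PF]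
    · simp [mul_comm]
    · intro x hx
      exact ((mem_PF F).1 hx).2.2
  · intro a _ b _ hab
    rw [Function.onFun, Finset.disjoint_left]
    intro x hx hx'
    rw [mem_PF] at hx hx'
    exact hab (hx.2.2.symm.trans hx'.2.2)
  · simp [mem_PF]; tauto

lemma piq_zero : piq F 0 = 0 := by
  rw [← card_PF, Finset.card_eq_zero, Finset.eq_empty_iff_forall_notMem]
  intro x hx
  rw [mem_PF] at hx
  exact hx.2.1.natDegree_pos.ne' hx.2.2

lemma mul_piq_le (r : ℕ) : r * piq F r ≤ Fintype.card F ^ r := by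
  rcases eq_or_ne r 0 with rfl | hr
  · simp
  · rw [← prime_count F r hr]
    exact Finset.single_le_sum (f := fun d => d * piq F d) (fun _ _ => Nat.zero_le _)
      (Nat.mem_divisors_self r hr)

lemma geom_pow_le (q m : ℕ) (hq : 2 ≤ q) : ∑ d ∈ Finset.range (m + 1), q ^ d ≤ 2 * q ^ m := by
  induction m with
  | zero => simp
  | succ m ih =>
    rw [Finset.sum_range_succ, pow_succ]
    nlinarith [Nat.mul_le_mul_left (q ^ m) hq]

lemma le_mul_piq (r : ℕ) (hr : r ≠ 0) :
    Fintype.card F ^ r ≤ r * piq F r + 2 * Fintype.card F ^ (r / 2) := by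
  have hq1 : 2 ≤ Fintype.card F := Fintype.one_lt_card
  rw [← prime_count F r hr, ← Nat.cons_self_properDivisors hr, Finset.sum_cons]
  gcongr
  refine le_trans (Finset.sum_le_sum (fun d _ => mul_piq_le F d)) ?_
  refine le_trans (Finset.sum_le_sum_of_subset ?_) (geom_pow_le _ _ hq1)
  intro d hd
  rw [Nat.mem_properDivisors] at hd
  obtain ⟨⟨c, rfl⟩, h2⟩ := hd
  rw [Finset.mem_range]
  have : 2 ≤ c := by
    by_contra h
    interval_cases c <;> simp at h2 hr
  have : d * 2 ≤ d * c := Nat.mul_le_mul_left _ this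
  omega

open Classical in
lemma omega_eq (n : ℕ) (f : F[X]) (hf : f ∈ MF F n) :
    (omegak F 1 f : ℝ) = ∑ r ∈ Finset.range (n + 1), ∑ l ∈ PF F r,
      ((if l ∣ f then (1 : ℝ) else 0) - if l ^ 2 ∣ f then (1 : ℝ) else 0) := by
  rw [mem_MF] at hf
  have h1 : omegak F 1 f = (((Finset.range (n + 1)).biUnion (PF F)).filter
      (fun l => l ∣ f ∧ ¬ l ^ 2 ∣ f)).card := by
    refine Nat.subtype_card _ (fun l => ?_)
    simp only [Finset.mem_filter, Finset.mem_biUnion, mem_PF, Finset.mem_range, pow_one]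
    constructor
    · rintro ⟨⟨r, _, h1, h2, _⟩, h3, h4⟩
      exact ⟨h1, h2, h3, h4⟩
    · rintro ⟨h1, h2, h3, h4⟩
      refine ⟨⟨l.natDegree, ?_, h1, h2, rfl⟩, h3, h4⟩
      have := natDegree_le_of_dvd h3 hf.1.ne_zero
      omega
  rw [h1, Finset.card_filter, Nat.cast_sum, Finset.sum_biUnion]
  · refine Finset.sum_congr rfl fun r _ => Finset.sum_congr rfl fun l _ => ?_
    by_cases h3 : l ^ 2 ∣ f
    · have : l ∣ f := (dvd_pow_self l two_ne_zero).trans h3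
      simp [h3, this]
    · simp [h3]
  · intro a _ b _ hab
    rw [Function.onFun, Finset.disjoint_left]
    intro x hx hx'
    rw [mem_PF] at hx hx'
    exact hab (hx.2.2.symm.trans hx'.2.2)

open Classical in
lemma moment_eq (n : ℕ) :
    (∑ᶠ f ∈ {f : Polynomial F | f.Monic ∧ f.natDegree = n}, (omegak F 1 f : ℝ)) =
      (Fintype.card F : ℝ) ^ n * (∑ r ∈ Finset.range (n + 1), (piq F r : ℝ) * ((Fintype.card F : ℝ) ^ r)⁻¹
        - ∑ r ∈ Finset.range (n / 2 + 1), (piq F r : ℝ) * (((Fintype.card F : ℝ) ^ r) ^ 2)⁻¹) := by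
  have hq0 : (Fintype.card F : ℝ) ≠ 0 := by exact_mod_cast Fintype.card_ne_zero
  rw [finsum_mem_eq_finite_toFinset_sum _ (finite_MS F n)]
  change ∑ f ∈ MF F n, _ = _
  rw [Finset.sum_congr rfl (omega_eq F n), Finset.sum_comm]
  have key : ∀ r ∈ Finset.range (n + 1), ∑ f ∈ MF F n, ∑ l ∈ PF F r,
      ((if l ∣ f then (1 : ℝ) else 0) - if l ^ 2 ∣ f then (1 : ℝ) else 0) =
      (Fintype.card F : ℝ) ^ n * ((piq F r : ℝ) * ((Fintype.card F : ℝ) ^ r)⁻¹) -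
      (Fintype.card F : ℝ) ^ n * (if r < n / 2 + 1 then (piq F r : ℝ) * (((Fintype.card F : ℝ) ^ r) ^ 2)⁻¹ else 0) := by
    intro r hr
    rw [Finset.mem_range] at hr
    rw [Finset.sum_comm, Finset.sum_congr rfl (g := fun _ => (Fintype.card F : ℝ) ^ n * ((Fintype.card F : ℝ) ^ r)⁻¹ -
      (Fintype.card F : ℝ) ^ n * (if r < n / 2 + 1 then (((Fintype.card F : ℝ) ^ r) ^ 2)⁻¹ else 0))]
    · rw [Finset.sum_const, card_PF, nsmul_eq_mul]
      split_ifs <;> ring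
    · intro l hl
      rw [mem_PF] at hl
      obtain ⟨h1, h2, rfl⟩ := hl
      have e1 := count_dvd F n l h1
      have e2 := count_dvd F n (l ^ 2) (h1.pow 2)
      rw [if_pos (by omega)] at e1
      rw [natDegree_pow] at e2
      rw [Finset.sum_sub_distrib, Finset.sum_boole, Finset.sum_boole, e1, e2]
      congr 1
      · push_cast
        rw [pow_sub₀ _ hq0 (by omega)]
      · by_cases h : l.natDegree < n / 2 + 1
        · rw [if_pos h, if_pos (by omega)]
          push_cast
          rw [pow_sub₀ _ hq0 (by omega), ← pow_mul, mul_comm 2]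
        · rw [if_neg h, if_neg (by omega)]; simp
  rw [Finset.sum_congr rfl key, Finset.sum_sub_distrib, ← Finset.mul_sum, ← Finset.mul_sum, mul_sub,
    ← Finset.sum_filter]
  congr 3
  ext r
  simp
  omega

/-- error term -/
noncomputable def er (r : ℕ) : ℝ := if r = 0 then 0 else
      ((piq F r : ℝ) - (Fintype.card F : ℝ) ^ r / r) * ((Fintype.card F : ℝ) ^ r)⁻¹

lemma half_pow_le {ρ : ℝ} (h0 : 0 ≤ ρ) (h1 : ρ ≤ 1) (h2 : ρ ^ 2 = 1 / 2) (m r : ℕ) (h : r ≤ 2 * m) :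
    (1 / 2 : ℝ) ^ m ≤ ρ ^ r := by
  rw [← h2, ← pow_mul]
  exact pow_le_pow_of_le_one h0 h1 h

lemma er_bound {ρ : ℝ} (h0 : 0 ≤ ρ) (h1 : ρ ≤ 1) (h2 : ρ ^ 2 = 1 / 2) (r : ℕ) :
    |er F r| ≤ 2 * ρ ^ r := by
  rw [er]
  split_ifs with hr
  · simp; positivity
  have hq1 : (2 : ℝ) ≤ Fintype.card F := by
    exact_mod_cast (Fintype.one_lt_card : 1 < Fintype.card F)
  set q : ℝ := ((Fintype.card F : ℕ) : ℝ) with hq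
  have hq0 : 0 < q := by linarith
  have hr1 : (1 : ℝ) ≤ r := by exact_mod_cast Nat.one_le_iff_ne_zero.2 hr
  have hr0 : (0 : ℝ) < r := by linarith
  have a1 : (r : ℝ) * piq F r ≤ q ^ r := by
    rw [hq]; exact_mod_cast mul_piq_le F r
  have a2 : q ^ r ≤ (r : ℝ) * piq F r + 2 * q ^ (r / 2) := by
    rw [hq]; exact_mod_cast le_mul_piq F r hr
  have a3 : |(piq F r : ℝ) - q ^ r / r| ≤ 2 * q ^ (r / 2) := by
    have : (piq F r : ℝ) - q ^ r / r = - ((q ^ r - r * piq F r) / r) := by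
      field_simp; ring
    rw [this, abs_neg, abs_of_nonneg (div_nonneg (by linarith) hr0.le)]
    refine le_trans (div_le_self (by linarith) hr1) (by linarith)
  rw [abs_mul, abs_of_nonneg (a := (q ^ r)⁻¹) (by positivity)]
  refine le_trans (mul_le_mul_of_nonneg_right a3 (by positivity)) ?_
  have a4 : q ^ r = q ^ (r / 2) * q ^ (r - r / 2) := by
    rw [← pow_add]; congr 1; omega
  have a5 : 2 * q ^ (r / 2) * (q ^ r)⁻¹ = 2 * (1 / q) ^ (r - r / 2) := by
    rw [a4, one_div, inv_pow]; field_simp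
  rw [a5]
  gcongr
  refine le_trans ?_ (half_pow_le h0 h1 h2 (r - r / 2) r (by omega))
  gcongr

lemma b_bound (r : ℕ) :
    |(piq F r : ℝ) * (((Fintype.card F : ℝ) ^ r) ^ 2)⁻¹| ≤ 1 * (1 / 2) ^ r := by
  have hq1 : (2 : ℝ) ≤ Fintype.card F := by
    exact_mod_cast (Fintype.one_lt_card : 1 < Fintype.card F)
  rcases eq_or_ne r 0 with rfl | hr
  · simp [piq_zero]
  have a1 : (piq F r : ℝ) ≤ (Fintype.card F : ℝ) ^ r := by
    exact_mod_cast le_trans (Nat.le_mul_of_pos_left _ (Nat.pos_of_ne_zero hr)) (mul_piq_le F r)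
  rw [abs_of_nonneg (by positivity), one_mul]
  set q : ℝ := ((Fintype.card F : ℕ) : ℝ) with hq
  have hq0 : 0 < q := by linarith
  calc (piq F r : ℝ) * ((q ^ r) ^ 2)⁻¹ ≤ q ^ r * ((q ^ r) ^ 2)⁻¹ := by gcongr
    _ = (1 / q) ^ r := by rw [one_div, inv_pow]; field_simp
    _ ≤ _ := by gcongr

lemma tail_bound {a : ℕ → ℝ} {C ρ : ℝ} (h0 : 0 ≤ ρ) (h1 : ρ < 1) (ha : ∀ r, |a r| ≤ C * ρ ^ r) (n : ℕ) :
    |∑ r ∈ Finset.range n, a r - ∑' r, a r| ≤ C * ρ ^ n * (1 - ρ)⁻¹ := by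
  have hg := (hasSum_geometric_of_lt_one h0 h1)
  have hs : Summable a := Summable.of_norm_bounded (hg.mul_left C).summable ha
  rw [← hs.sum_add_tsum_nat_add n, sub_add_cancel_left, abs_neg]
  rw [← Real.norm_eq_abs]
  refine tsum_of_norm_bounded (hg.mul_left (C * ρ ^ n)) (fun i => ?_)
  refine (ha _).trans (le_of_eq ?_)
  rw [pow_add]; ring

lemma Lc_eq : Lc F 2 = ∑' r, (piq F r : ℝ) * (((Fintype.card F : ℝ) ^ r) ^ 2)⁻¹ := by
  have hfin : ∀ r, Nat.card {l : {l : Polynomial F // l.Monic ∧ Irreducible l} // l.1.natDegree = r} = piq F r := by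
    intro r
    rw [piq]
    refine Nat.card_congr ((Equiv.subtypeSubtypeEquivSubtypeInter
      (fun l : F[X] => l.Monic ∧ Irreducible l) (fun l => l.natDegree = r)).trans
      (Equiv.subtypeEquivRight ?_))
    intro x; tauto
  have hfinite : ∀ r, Finite {l : {l : Polynomial F // l.Monic ∧ Irreducible l} // l.1.natDegree = r} := by
    intro r
    have : Finite {l : Polynomial F // l ∈ PF F r} := inferInstance
    refine Finite.of_injective (β := {l : Polynomial F // l ∈ PF F r})
      (fun l => ⟨l.1.1, (mem_PF F).2 ⟨l.1.2.1, l.1.2.2, l.2⟩⟩) ?_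
    intro a b hab
    apply Subtype.ext; apply Subtype.ext
    simpa using hab
  rw [Lc, ← (Equiv.sigmaFiberEquiv (fun l : {l : Polynomial F // l.Monic ∧ Irreducible l} => l.1.natDegree)).tsum_eq]
  have hin : ∀ r, ∑' l : {l : {l : Polynomial F // l.Monic ∧ Irreducible l} // l.1.natDegree = r},
      (((Fintype.card F : ℝ) ^ (l.1.1).natDegree) ^ 2)⁻¹ = (piq F r : ℝ) * (((Fintype.card F : ℝ) ^ r) ^ 2)⁻¹ := by
    intro r
    rw [tsum_congr (g := fun _ => (((Fintype.card F : ℝ) ^ r) ^ 2)⁻¹), tsum_const, hfin, nsmul_eq_mul]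
    intro l; rw [l.2]
  rw [Summable.tsum_sigma']
  · exact tsum_congr hin
  · intro r
    have := hfinite r
    exact Summable.of_finite
  · rw [summable_sigma_of_nonneg]
    · refine ⟨fun r => ?_, ?_⟩
      · have := hfinite r
        exact Summable.of_finite
      · refine Summable.congr (f := fun r => (piq F r : ℝ) * (((Fintype.card F : ℝ) ^ r) ^ 2)⁻¹) ?_ (fun r => (hin r).symm)
        exact Summable.of_norm_bounded ((hasSum_geometric_of_lt_one (by norm_num) (by norm_num)).mul_left 1).summable (b_bound F)
    · intro x; positivity

lemma harmonic_bound (n : ℕ) (hn : 0 < n) :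
    |∑ r ∈ Finset.range (n + 1), (1 : ℝ) / r - Real.log n - Real.eulerMascheroniConstant| ≤ 1 / n := by
  have hh : ∑ r ∈ Finset.range (n + 1), (1 : ℝ) / r = (harmonic n : ℝ) := by
    rw [Finset.sum_range_succ', harmonic]; simp
  have a1 := Real.eulerMascheroniSeq_lt_eulerMascheroniConstant n
  have a2 := Real.eulerMascheroniConstant_lt_eulerMascheroniSeq' n
  rw [Real.eulerMascheroniSeq] at a1
  rw [Real.eulerMascheroniSeq', if_neg hn.ne'] at a2
  have hn' : (0 : ℝ) < n := by exact_mod_cast hn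
  have a3 : Real.log (n + 1) - Real.log n ≤ 1 / n := by
    rw [← Real.log_div (by positivity) (by positivity)]
    refine (Real.log_le_sub_one_of_pos (by positivity)).trans (le_of_eq ?_)
    field_simp; ring
  rw [hh, abs_of_nonneg (by linarith)]
  linarith
end
/-- First moment of ω₁ over monic polynomials of degree n. -/
theorem first_moment_omega_one (F : Type*) [Field F] [Fintype F] :
    (fun n : ℕ =>
        (∑ᶠ f ∈ {f : Polynomial F | f.Monic ∧ f.natDegree = n},
            (omegak F 1 f : ℝ)) -
          ((Fintype.card F : ℝ) ^ n * Real.log n +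
            (Fintype.card F : ℝ) ^ n * (A1 F - Lc F 2)))
      =O[atTop] (fun n : ℕ => (Fintype.card F : ℝ) ^ n / n) := by
  obtain ⟨ρ, h0, h1, h2⟩ : ∃ ρ : ℝ, 0 ≤ ρ ∧ ρ < 1 ∧ ρ ^ 2 = 1 / 2 := by
    refine ⟨√(1 / 2), by positivity, ?_, Real.sq_sqrt (by norm_num)⟩
    rw [Real.sqrt_lt' one_pos]; norm_num
  have hq0 : (0 : ℝ) < Fintype.card F := by exact_mod_cast Fintype.card_pos
  obtain ⟨K, hK⟩ := (tendsto_self_mul_const_pow_of_lt_one h0 h1).bddAbove_range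
  have hK' : ∀ n : ℕ, n * ρ ^ n ≤ K := fun n => hK ⟨n, rfl⟩
  have hρ : 0 < (1 - ρ)⁻¹ := inv_pos.2 (by linarith)
  apply IsBigO.of_bound (1 + 2 * K * (1 - ρ)⁻¹ + K * (1 - 1 / 2 : ℝ)⁻¹)
  filter_upwards [eventually_gt_atTop 0] with n hn
  have hn' : (0 : ℝ) < n := by exact_mod_cast hn
  have hKn : ρ ^ n ≤ K / n := by
    rw [le_div_iff₀ hn', mul_comm]; exact hK' n
  have b1 := harmonic_bound n hn
  have b2 := tail_bound h0 h1 (er_bound F h0 h1.le h2) (n + 1)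
  have b3 := tail_bound (by norm_num) (by norm_num) (b_bound F) (n / 2 + 1)
  rw [← Lc_eq] at b3
  have b2' : 2 * ρ ^ (n + 1) * (1 - ρ)⁻¹ ≤ 2 * (K / n) * (1 - ρ)⁻¹ := by
    gcongr
    exact (pow_le_pow_of_le_one h0 h1.le (Nat.le_succ n)).trans hKn
  have b3' : 1 * (1 / 2 : ℝ) ^ (n / 2 + 1) * (1 - 1 / 2 : ℝ)⁻¹ ≤ 1 * (K / n) * (1 - 1 / 2 : ℝ)⁻¹ := by
    gcongr
    exact (half_pow_le h0 h1.le h2 _ n (by omega)).trans hKn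
  have hsplit : ∑ r ∈ Finset.range (n + 1), (piq F r : ℝ) * ((Fintype.card F : ℝ) ^ r)⁻¹ =
      ∑ r ∈ Finset.range (n + 1), (1 : ℝ) / r + ∑ r ∈ Finset.range (n + 1), er F r := by
    rw [← Finset.sum_add_distrib]
    refine Finset.sum_congr rfl fun r _ => ?_
    rw [er]
    split_ifs with hr
    · subst hr; simp [piq_zero]
    · have : (r : ℝ) ≠ 0 := by exact_mod_cast hr
      field_simp; ring
  have hA : A1 F = Real.eulerMascheroniConstant + ∑' r, er F r := rfl
  have hm := moment_eq F n
  simp only [Set.mem_ofPred_eq] at hm ⊢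
  rw [hm, hsplit, hA, ← mul_add, ← mul_sub, norm_mul, norm_div, Real.norm_eq_abs,
    Real.norm_eq_abs, Real.norm_eq_abs, abs_of_pos hn', abs_of_pos (pow_pos hq0 n), mul_div_assoc', 
    mul_comm _ ((Fintype.card F : ℝ) ^ n), mul_div_assoc]
  refine mul_le_mul_of_nonneg_left ?_ (by positivity)
  have hfin : (1 + 2 * K * (1 - ρ)⁻¹ + K * (1 - 1 / 2 : ℝ)⁻¹) / n =
    1 / n + 2 * (K / n) * (1 - ρ)⁻¹ + 1 * (K / n) * (1 - 1 / 2 : ℝ)⁻¹ := by ring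
  rw [hfin]
  rw [abs_le] at *
  constructor <;> linarith [b1.1, b1.2, b2.1, b2.2, b3.1, b3.2]
end

section
/- Let F_q be a finite field with q elements and k ≥ 2 a fixed integer. Let ω_k(f) be the number of distinct monic irreducible factors of f ∈ F_q[t] with multiplicity exactly k, and L(m) = Σ_{l ∈ P} |l|^{-m} where P is the set of monic irreducible polynomials. Then as n → ∞, Σ_{f ∈ M_n} ω_k(f) = (L(k) - L(k+1)) q^n + O(n · q^{n/k}). -/
open Filter Asymptotics Real Polynomial

/-- monic irreducible polynomials -/
abbrev FmoIrr (F : Type*) [Field F] : Type _ := {l : Polynomial F // l.Monic ∧ Irreducible l}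

lemma fmo_monic_finite (F : Type*) [Field F] [Fintype F] (n : ℕ) :
    {f : Polynomial F | f.Monic ∧ f.natDegree = n}.Finite := by
  have e := (Polynomial.monicEquivDegreeLT (R := F) n).trans (degreeLTEquiv F n).toEquiv
  have : Finite {p : Polynomial F // p.Monic ∧ p.natDegree = n} := Finite.of_equiv _ e.symm
  exact Set.finite_coe_iff.1 this

lemma fmo_monic_card (F : Type*) [Field F] [Fintype F] (n : ℕ) :
    (fmo_monic_finite F n).toFinset.card = Fintype.card F ^ n := by
  have e := (Polynomial.monicEquivDegreeLT (R := F) n).trans (degreeLTEquiv F n).toEquiv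
  rw [← Set.ncard_eq_toFinset_card _ (fmo_monic_finite F n)]
  have : Nat.card {p : Polynomial F // p.Monic ∧ p.natDegree = n} = Fintype.card F ^ n := by
    rw [Nat.card_congr e]; simp
  exact this

open Classical in
lemma fmo_count (F : Type*) [Field F] [Fintype F] (n : ℕ) (g : Polynomial F) (hg : g.Monic) :
    ((fmo_monic_finite F n).toFinset.filter (fun f => g ∣ f)).card =
      if g.natDegree ≤ n then Fintype.card F ^ (n - g.natDegree) else 0 := by
  split_ifs with h
  · rw [← fmo_monic_card F (n - g.natDegree)]
    symm
    apply Finset.card_bij (fun a _ => g * a)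
    · intro a ha
      simp only [Set.Finite.mem_toFinset, Set.mem_ofPred_eq, Finset.mem_filter] at ha ⊢
      refine ⟨⟨hg.mul ha.1, ?_⟩, dvd_mul_right _ _⟩
      rw [hg.natDegree_mul ha.1, ha.2]; omega
    · intro a _ b _ hab
      exact mul_left_cancel₀ hg.ne_zero hab
    · intro b hb
      simp only [Set.Finite.mem_toFinset, Set.mem_ofPred_eq, Finset.mem_filter] at hb
      obtain ⟨⟨h1, h2⟩, c, rfl⟩ := hb
      have hc : c.Monic := hg.of_mul_monic_left h1
      refine ⟨c, ?_, rfl⟩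
      simp only [Set.Finite.mem_toFinset, Set.mem_ofPred_eq]
      refine ⟨hc, ?_⟩
      rw [hg.natDegree_mul hc] at h2; omega
  · rw [Finset.card_eq_zero, Finset.filter_eq_empty_iff]
    intro f hf hd
    simp only [Set.Finite.mem_toFinset, Set.mem_ofPred_eq] at hf
    exact h (hf.2 ▸ natDegree_le_of_dvd hd hf.1.ne_zero)

lemma fmo_tail (F : Type*) [Field F] [Fintype F] (m : ℕ) (hm : 2 ≤ m) (r : ℕ)
    (T : Finset {l : Polynomial F // l.Monic ∧ Irreducible l})
    (hT : ∀ l ∈ T, r ≤ (l : Polynomial F).natDegree) :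
    ∑ l ∈ T, (((Fintype.card F : ℝ) ^ (l : Polynomial F).natDegree) ^ m)⁻¹ ≤
      2 * ((Fintype.card F : ℝ) ^ ((m - 1) * r))⁻¹ := by
  classical
  set q : ℝ := (Fintype.card F : ℝ) with hq
  have hq2 : (2 : ℝ) ≤ q := by
    have : 1 < Fintype.card F := Fintype.one_lt_card
    rw [hq]; exact_mod_cast this
  have hq0 : 0 < q := by linarith
  set D := T.sup (fun l : FmoIrr F => (l : Polynomial F).natDegree) + 1 with hD
  have hmap : ∀ l ∈ T, (l : Polynomial F).natDegree ∈ Finset.Ico r D := by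
    intro l hl
    rw [Finset.mem_Ico]
    refine ⟨hT l hl, ?_⟩
    rw [hD]
    exact Nat.lt_succ_of_le
      (Finset.le_sup (f := fun l : {l : Polynomial F // l.Monic ∧ Irreducible l} =>
        (l : Polynomial F).natDegree) hl)
  rw [← Finset.sum_fiberwise_of_maps_to hmap]
  have hfib : ∀ d, ∑ l ∈ T with l.1.natDegree = d,
      ((q ^ (l : Polynomial F).natDegree) ^ m)⁻¹ ≤ (q ^ ((m - 1) * d))⁻¹ := by
    intro d
    have h1 : ∑ l ∈ T with l.1.natDegree = d,
        ((q ^ (l : Polynomial F).natDegree) ^ m)⁻¹ =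
        (T.filter (fun l : FmoIrr F => (l : Polynomial F).natDegree = d)).card * ((q ^ d) ^ m)⁻¹ := by
      rw [← nsmul_eq_mul]
      apply Finset.sum_eq_card_nsmul
      intro l hl
      rw [(Finset.mem_filter.1 hl).2]
    have h2 : (T.filter (fun l : FmoIrr F => (l : Polynomial F).natDegree = d)).card ≤
        Fintype.card F ^ d := by
      rw [← fmo_monic_card F d]
      apply Finset.card_le_card_of_injOn (fun l : FmoIrr F => (l : Polynomial F))
      · intro l hl
        have := (Finset.mem_filter.1 hl).2
        simp [this, l.2.1]
      · intro a _ b _ hab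
        exact Subtype.ext hab
    have h3 : ((T.filter (fun l : FmoIrr F => (l : Polynomial F).natDegree = d)).card : ℝ) ≤ q ^ d := by
      rw [hq]; exact_mod_cast h2
    rw [h1]
    calc _ ≤ q ^ d * ((q ^ d) ^ m)⁻¹ := by gcongr
      _ = (q ^ ((m - 1) * d))⁻¹ := by
        obtain ⟨j, rfl⟩ : ∃ j, m = j + 1 := ⟨m - 1, by omega⟩
        rw [Nat.add_sub_cancel, pow_succ, mul_comm j d, pow_mul]
        field_simp
  calc _ ≤ ∑ d ∈ Finset.Ico r D, (q ^ ((m - 1) * d))⁻¹ := Finset.sum_le_sum fun d _ => hfib d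
    _ = ∑ j ∈ Finset.range (D - r), (q ^ ((m - 1) * (r + j)))⁻¹ := by
      rw [Finset.sum_Ico_eq_sum_range]
    _ ≤ ∑ j ∈ Finset.range (D - r), (1 / 2 : ℝ) ^ j * (q ^ ((m - 1) * r))⁻¹ := by
      apply Finset.sum_le_sum
      intro j _
      rw [mul_add, pow_add, mul_inv, mul_comm]
      gcongr
      rw [one_div, inv_pow]
      gcongr
      calc (2 : ℝ) ^ j ≤ q ^ j := by gcongr
        _ ≤ q ^ ((m - 1) * j) := by
          apply pow_le_pow_right₀ (by linarith)
          exact Nat.le_mul_of_pos_left _ (by omega)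
    _ ≤ _ := by
      rw [← Finset.sum_mul]
      exact mul_le_mul_of_nonneg_right (sum_geometric_two_le _) (by positivity)

lemma fmo_irr_finite (F : Type*) [Field F] [Fintype F] (n : ℕ) :
    {l : {l : Polynomial F // l.Monic ∧ Irreducible l} |
      (l : Polynomial F).natDegree ≤ n}.Finite := by
  have h : (⋃ d ∈ Set.Iic n, {f : Polynomial F | f.Monic ∧ f.natDegree = d}).Finite :=
    (Set.finite_Iic n).biUnion fun d _ => fmo_monic_finite F d
  apply Set.Finite.of_finite_image (f := Subtype.val) _ Subtype.val_injective.injOn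
  apply h.subset
  rintro _ ⟨l, hl, rfl⟩
  simp only [Set.mem_iUnion]
  exact ⟨_, hl, l.2.1, rfl⟩

open Classical in
/-- the sum over `l` of the number of multiples of `l ^ m`, compared with `L(m) q ^ n` -/
lemma fmo_error (F : Type*) [Field F] [Fintype F] (m : ℕ) (hm : 2 ≤ m) (n : ℕ) :
    |(∑ l ∈ (fmo_irr_finite F n).toFinset,
        (((fmo_monic_finite F n).toFinset.filter
          (fun f => (l : Polynomial F) ^ m ∣ f)).card : ℝ)) -
      Lc F m * (Fintype.card F : ℝ) ^ n| ≤ 2 * (Fintype.card F : ℝ) ^ ((n : ℝ) / m) := by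
  set q : ℝ := (Fintype.card F : ℝ) with hq
  have hq2 : (2 : ℝ) ≤ q := by
    have : 1 < Fintype.card F := Fintype.one_lt_card
    rw [hq]; exact_mod_cast this
  have hq0 : 0 < q := by linarith
  set A := (fmo_irr_finite F n).toFinset.filter
    (fun l : FmoIrr F => m * (l : Polynomial F).natDegree ≤ n) with hA
  set f : {l : Polynomial F // l.Monic ∧ Irreducible l} → ℝ :=
    fun l => ((q ^ (l : Polynomial F).natDegree) ^ m)⁻¹ with hf
  have hf0 : ∀ l, 0 ≤ f l := fun l => by positivity
  have hsum : Summable f := summable_of_sum_le hf0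
    (fun T => fmo_tail F m hm 0 T (fun _ _ => Nat.zero_le _))
  have hL : Lc F m = ∑' l, f l := rfl
  set B : ℝ := 2 * (q ^ ((m - 1) * (n / m + 1)))⁻¹ with hB
  have hlow : ∑ l ∈ A, f l ≤ Lc F m := hsum.sum_le_tsum A fun l _ => hf0 l
  have hup : Lc F m ≤ ∑ l ∈ A, f l + B := by
    rw [hL]
    apply hsum.tsum_le_of_sum_le
    intro T
    have h1 : ∑ l ∈ T, f l = ∑ l ∈ T ∩ A, f l + ∑ l ∈ T \ A, f l :=
      (Finset.sum_inter_add_sum_sdiff T A f).symm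
    rw [h1]
    apply add_le_add
    · exact Finset.sum_le_sum_of_subset_of_nonneg Finset.inter_subset_right fun l _ _ => hf0 l
    · apply fmo_tail F m hm
      intro l hl
      have hl' := (Finset.mem_sdiff.1 hl).2
      by_contra! hlt
      apply hl'
      have h2 : (l : Polynomial F).natDegree ≤ n / m := by omega
      have h3 := (Nat.le_div_iff_mul_le (by omega)).1 h2
      have h4 : m * (l : Polynomial F).natDegree ≤ n := by rw [mul_comm]; exact h3
      simp only [hA, Finset.mem_filter, Set.Finite.mem_toFinset, Set.mem_ofPred_eq]
      exact ⟨h2.trans (Nat.div_le_self _ _), h4⟩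
  have hS : (∑ l ∈ (fmo_irr_finite F n).toFinset,
        (((fmo_monic_finite F n).toFinset.filter
          (fun f => (l : Polynomial F) ^ m ∣ f)).card : ℝ)) = (∑ l ∈ A, f l) * q ^ n := by
    rw [hA, Finset.sum_filter, Finset.sum_mul]
    apply Finset.sum_congr rfl
    intro l _
    rw [fmo_count F n _ (l.2.1.pow m), natDegree_pow]
    split_ifs with h
    · push_cast
      rw [← hq, hf]
      simp only
      rw [pow_sub₀ _ hq0.ne' h, ← pow_mul, mul_comm m, mul_comm]
    · simp
  have hBq : B * q ^ n ≤ 2 * q ^ ((n : ℝ) / m) := by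
    rw [hB, mul_assoc]
    gcongr
    rw [← Real.rpow_natCast, ← Real.rpow_natCast, ← Real.rpow_neg hq0.le, ← Real.rpow_add hq0]
    apply Real.rpow_le_rpow_of_exponent_le (by linarith)
    have hm0 : (0 : ℝ) < m := by
      have : 0 < m := by omega
      exact_mod_cast this
    have hm1 : (1 : ℝ) ≤ m := by
      have : 1 ≤ m := by omega
      exact_mod_cast this
    have h5 : (n : ℝ) / m ≤ ((n / m + 1 : ℕ) : ℝ) := by
      rw [div_le_iff₀ hm0]
      have : n ≤ (n / m + 1) * m := by
        have := Nat.lt_div_mul_add (a := n) (b := m) (by omega)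
        rw [add_mul, one_mul]; exact this.le
      exact_mod_cast this
    rw [Nat.cast_mul, Nat.cast_sub (by omega), Nat.cast_one]
    have h6 : ((m : ℝ) - 1) * ((n : ℝ) / m) ≤ ((m : ℝ) - 1) * ((n / m + 1 : ℕ) : ℝ) :=
      mul_le_mul_of_nonneg_left h5 (by linarith)
    have h7 : ((m : ℝ) - 1) * ((n : ℝ) / m) = n - n / m := by field_simp
    linarith
  have hqn : 0 < q ^ n := by positivity
  rw [hS, ← sub_mul, abs_mul, abs_of_pos hqn]
  refine le_trans ?_ hBq
  gcongr
  rw [abs_le]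
  constructor <;> linarith

open Classical in
lemma fmo_omegak (F : Type*) [Field F] [Fintype F] (k : ℕ) (hk : 2 ≤ k) (n : ℕ)
    (f : Polynomial F) (hf : f ∈ (fmo_monic_finite F n).toFinset) :
    (omegak F k f : ℝ) = ∑ l ∈ (fmo_irr_finite F n).toFinset,
      ((if (l : Polynomial F) ^ k ∣ f then (1 : ℝ) else 0) -
        (if (l : Polynomial F) ^ (k + 1) ∣ f then (1 : ℝ) else 0)) := by
  simp only [Set.Finite.mem_toFinset, Set.mem_ofPred_eq] at hf
  have h1 : omegak F k f = ((fmo_irr_finite F n).toFinset.filter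
      (fun l : FmoIrr F => (l : Polynomial F) ^ k ∣ f ∧ ¬ (l : Polynomial F) ^ (k + 1) ∣ f)).card := by
    unfold omegak
    rw [← Nat.card_eq_finsetCard]
    refine Nat.card_congr ⟨fun l => ⟨⟨l.1, l.2.1, l.2.2.1⟩, ?_⟩,
      fun l => ⟨l.1.1, l.1.2.1, l.1.2.2, ?_⟩, fun _ => rfl, fun _ => rfl⟩
    · simp only [Finset.mem_filter, Set.Finite.mem_toFinset, Set.mem_ofPred_eq]
      refine ⟨?_, l.2.2.2⟩
      rw [← hf.2]
      exact natDegree_le_of_dvd ((dvd_pow_self _ (by omega)).trans l.2.2.2.1) hf.1.ne_zero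
    · exact (Finset.mem_filter.1 l.2).2
  rw [h1, Finset.card_filter]
  push_cast
  apply Finset.sum_congr rfl
  intro l _
  by_cases ha : (l : Polynomial F) ^ (k + 1) ∣ f
  · have hb : (l : Polynomial F) ^ k ∣ f := (pow_dvd_pow _ (Nat.le_succ k)).trans ha
    simp [ha, hb]
  · simp [ha]

/-- First moment of ω_k, k ≥ 2, over monic polynomials of degree n. -/
theorem first_moment_omega_k (F : Type*) [Field F] [Fintype F] (k : ℕ) (hk : 2 ≤ k) :
    (fun n : ℕ =>
        (∑ᶠ f ∈ {f : Polynomial F | f.Monic ∧ f.natDegree = n},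
            (omegak F k f : ℝ)) -
          (Lc F k - Lc F (k + 1)) * (Fintype.card F : ℝ) ^ n)
      =O[atTop] (fun n : ℕ => (n : ℝ) * (Fintype.card F : ℝ) ^ ((n : ℝ) / k)) := by
  classical
  set q : ℝ := (Fintype.card F : ℝ) with hq
  have hq2 : (2 : ℝ) ≤ q := by
    have : 1 < Fintype.card F := Fintype.one_lt_card
    rw [hq]; exact_mod_cast this
  have hq0 : 0 < q := by linarith
  apply IsBigO.of_bound 4
  refine eventually_atTop.2 ⟨1, fun n hn => ?_⟩
  have hn1 : (1 : ℝ) ≤ n := by exact_mod_cast hn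
  have hk0 : (0 : ℝ) < k := by
    have : 0 < k := by omega
    exact_mod_cast this
  rw [finsum_mem_eq_finite_toFinset_sum _ (fmo_monic_finite F n),
    Finset.sum_congr rfl (fun f hf => fmo_omegak F k hk n f hf), Finset.sum_comm]
  simp only [Finset.sum_sub_distrib, Finset.sum_boole]
  have h1 := fmo_error F k hk n
  have h2 := fmo_error F (k + 1) (by omega) n
  rw [← hq] at h1 h2
  have hp : 0 < q ^ ((n : ℝ) / k) := Real.rpow_pos_of_pos hq0 _
  have h3 : q ^ ((n : ℝ) / (k + 1 : ℕ)) ≤ q ^ ((n : ℝ) / k) := by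
    apply Real.rpow_le_rpow_of_exponent_le (by linarith)
    push_cast
    gcongr
    linarith
  have h4 : q ^ ((n : ℝ) / k) ≤ n * q ^ ((n : ℝ) / k) := le_mul_of_one_le_left hp.le hn1
  rw [Real.norm_eq_abs, Real.norm_eq_abs, abs_of_pos (show 0 < (n : ℝ) * q ^ ((n : ℝ) / k) by
    positivity), sub_mul]
  rw [abs_le] at h1 h2 ⊢
  constructor <;> linarith [h1.1, h1.2, h2.1, h2.2]
end

section
/- Let F_q be a finite field with q elements, P the monic irreducibles in F_q[t], and L(m) = Σ_{l∈P}|l|^{-m}. As n → ∞, S₁(n) := Σ over pairs of distinct monic irreducibles l ≠ h with deg(lh) ≤ n of 1/(|l||h|) satisfies S₁(n) = (log n)² + 2A₁ log n + A₁² - π²/6 - L(2) + O((log n)/n), where A₁ = γ + Σ_{r≥1}(π_q(r)-q^r/r)q^{-r}. -/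
open Filter Asymptotics Real Polynomial

section Count
variable (F : Type*) [Field F] [Fintype F]

open UniqueFactorizationMonoid in
lemma exists_T (n : ℕ) (hn : n ≠ 0) : ∃ T : Finset F[X],
    (∀ l, l ∈ T ↔ l.Monic ∧ Irreducible l ∧ l.natDegree ∣ n) ∧
    ∑ l ∈ T, l.natDegree = (Fintype.card F) ^ n := by
  classical
  have hq : 1 < Fintype.card F := Fintype.one_lt_card
  set G : F[X] := X ^ (Fintype.card F) ^ n - X with hG
  have hG0 : G ≠ 0 := FiniteField.X_pow_card_pow_sub_X_ne_zero F hn hq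
  have hdeg : G.natDegree = (Fintype.card F) ^ n :=
    FiniteField.X_pow_card_pow_sub_X_natDegree_eq F hn hq
  have hsep : G.Separable := by
    obtain ⟨p, hp⟩ := CharP.exists F
    apply galois_poly_separable p
    refine dvd_trans ?_ (dvd_pow_self _ hn)
    rw [← CharP.cast_eq_zero_iff F p]
    exact FiniteField.cast_card_eq_zero F
  have hmonic : G.Monic := by
    apply monic_X_pow_sub
    rw [degree_X]
    exact_mod_cast Nat.one_lt_pow hn hq
  have hnd : (normalizedFactors G).Nodup :=
    (squarefree_iff_nodup_normalizedFactors hG0).1 hsep.squarefree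
  have hmem : ∀ l, l ∈ normalizedFactors G → l.Monic ∧ Irreducible l := by
    intro l hl
    have h1 := irreducible_of_normalized_factor l hl
    refine ⟨?_, h1⟩
    rw [← normalize_normalized_factor l hl]
    exact monic_normalize h1.ne_zero
  have hprod : (normalizedFactors G).prod = G := by
    rw [prod_normalizedFactors_eq hG0]
    exact hmonic.normalize_eq_self
  refine ⟨(normalizedFactors G).toFinset, ?_, ?_⟩
  · intro l
    rw [Multiset.mem_toFinset]
    constructor
    · intro hl
      have h1 := hmem l hl
      refine ⟨h1.1, h1.2, ?_⟩
      apply Irreducible.natDegree_dvd_of_dvd_X_pow_card_pow_sub_X h1.2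
      rw [Nat.card_eq_fintype_card]
      exact dvd_of_mem_normalizedFactors hl
    · rintro ⟨h1, h2, h3⟩
      have := (Irreducible.natDegree_dvd_iff_dvd_X_pow_card_pow_sub_X h2).1 h3
      rw [Nat.card_eq_fintype_card] at this
      obtain ⟨l', hl', ha⟩ := exists_mem_normalizedFactors_of_dvd hG0 h2 this
      rwa [eq_of_monic_of_associated h1 (hmem l' hl').1 ha]
  · rw [← hdeg, Finset.sum_eq_multiset_sum, Multiset.toFinset_val, hnd.dedup]
    conv_rhs => rw [← hprod]
    rw [natDegree_multiset_prod_of_monic]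
    exact fun l hl => (hmem l hl).1

lemma exists_J (r : ℕ) : ∃ J : Finset F[X],
    (∀ l, l ∈ J ↔ l.Monic ∧ Irreducible l ∧ l.natDegree = r) := by
  classical
  rcases eq_or_ne r 0 with rfl | hr
  · refine ⟨∅, fun l => ⟨fun h => absurd h (Finset.notMem_empty _), ?_⟩⟩
    rintro ⟨-, h2, h3⟩
    exact absurd h2.natDegree_pos (by omega)
  · obtain ⟨T, hT, -⟩ := exists_T F r hr
    refine ⟨T.filter (fun l => l.natDegree = r), fun l => ?_⟩
    rw [Finset.mem_filter, hT]
    constructor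
    · rintro ⟨⟨a, b, c⟩, d⟩; exact ⟨a, b, d⟩
    · rintro ⟨a, b, d⟩; exact ⟨⟨a, b, d ▸ dvd_rfl⟩, d⟩

/-- monic irreducibles of degree `r` -/
noncomputable def JJ (r : ℕ) : Finset F[X] := (exists_J F r).choose

lemma mem_JJ {r : ℕ} {l : F[X]} :
    l ∈ JJ F r ↔ l.Monic ∧ Irreducible l ∧ l.natDegree = r := (exists_J F r).choose_spec l

lemma card_JJ (r : ℕ) : piq F r = (JJ F r).card := by
  unfold piq
  rw [← Nat.card_eq_finsetCard]
  exact Nat.card_congr (Equiv.subtypeEquivRight fun l => (mem_JJ F).symm)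

lemma sum_piq (n : ℕ) (hn : n ≠ 0) :
    ∑ d ∈ n.divisors, d * piq F d = (Fintype.card F) ^ n := by
  classical
  obtain ⟨T, hT, hs⟩ := exists_T F n hn
  rw [← hs, ← Finset.sum_fiberwise_of_maps_to (s := T) (t := n.divisors) (g := natDegree)]
  · refine Finset.sum_congr rfl fun d hd => ?_
    have : T.filter (fun l => l.natDegree = d) = JJ F d := by
      ext l
      rw [Finset.mem_filter, hT, mem_JJ]
      have := Nat.dvd_of_mem_divisors hd
      constructor
      · rintro ⟨⟨a, b, c⟩, d⟩; exact ⟨a, b, d⟩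
      · rintro ⟨a, b, d⟩; exact ⟨⟨a, b, d ▸ this⟩, d⟩
    rw [this, card_JJ, mul_comm, ← smul_eq_mul, ← Finset.sum_const]
    exact Finset.sum_congr rfl fun l hl => ((mem_JJ F).1 hl).2.2.symm
  · intro l hl
    exact Nat.mem_divisors.2 ⟨((hT l).1 hl).2.2, hn⟩

lemma piq_upper (n : ℕ) : n * piq F n ≤ (Fintype.card F) ^ n := by
  rcases eq_or_ne n 0 with rfl | hn
  · simp
  rw [← sum_piq F n hn]
  exact Finset.single_le_sum (f := fun d => d * piq F d) (fun _ _ => Nat.zero_le _)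
    (Nat.mem_divisors_self n hn)

lemma piq_lower (n : ℕ) (hn : n ≠ 0) :
    (Fintype.card F) ^ n ≤ n * piq F n + n * (Fintype.card F) ^ (n / 2) := by
  rw [← sum_piq F n hn, ← Nat.cons_self_properDivisors hn, Finset.sum_cons]
  gcongr
  calc ∑ d ∈ n.properDivisors, d * piq F d
      ≤ ∑ d ∈ n.properDivisors, (Fintype.card F) ^ (n / 2) := by
        refine Finset.sum_le_sum fun d hd => (piq_upper F d).trans ?_
        refine Nat.pow_le_pow_right Fintype.card_pos ?_
        obtain ⟨⟨k, rfl⟩, h2⟩ := Nat.mem_properDivisors.1 hd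
        have hk : 2 ≤ k := by
          rcases k with _ | _ | k <;> simp_all
        rw [Nat.le_div_iff_mul_le two_pos]
        exact Nat.mul_le_mul_left d hk
    _ ≤ _ := by
        rw [Finset.sum_const, smul_eq_mul]
        gcongr
        exact (Finset.card_le_card (Finset.filter_subset _ _)).trans (by simp)

/-- the error terms -/
noncomputable def ee (r : ℕ) : ℝ := if r = 0 then 0 else
      ((piq F r : ℝ) - (Fintype.card F : ℝ) ^ r / r) * ((Fintype.card F : ℝ) ^ r)⁻¹

lemma abs_ee_le (r : ℕ) : |ee F r| ≤ ((√2)⁻¹) ^ r := by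
  unfold ee
  split_ifs with hr
  · simp
  have hr' : (0 : ℝ) < r := by positivity
  have hq : (2 : ℝ) ≤ Fintype.card F := by exact_mod_cast (Fintype.one_lt_card (α := F))
  set q : ℝ := (Fintype.card F : ℝ) with hqd
  have hqp : 0 < q := by linarith
  have h1 : (r : ℝ) * piq F r ≤ q ^ r := by rw [hqd]; exact_mod_cast piq_upper F r
  have h2 : q ^ r ≤ r * piq F r + r * q ^ (r / 2) := by rw [hqd]; exact_mod_cast piq_lower F r hr
  have h3 : |(piq F r : ℝ) - q ^ r / r| ≤ q ^ (r / 2) := by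
    rw [abs_le]
    constructor
    · have : q ^ r / r ≤ piq F r + q ^ (r / 2) := by
        rw [div_le_iff₀ hr']; linarith
      linarith
    · have : (piq F r : ℝ) ≤ q ^ r / r := by
        rw [le_div_iff₀ hr']; linarith
      have : 0 < q ^ (r / 2) := by positivity
      linarith
  have hsq : 1 ≤ √q := by rw [Real.one_le_sqrt]; linarith
  have h4 : q ^ (r / 2) ≤ (√q) ^ r := by
    calc q ^ (r / 2) = (√q) ^ (2 * (r / 2)) := by rw [pow_mul, Real.sq_sqrt hqp.le]
      _ ≤ _ := pow_le_pow_right₀ hsq (by omega)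
  have h5 : q ^ r = (√q) ^ r * (√q) ^ r := by
    rw [← mul_pow, Real.mul_self_sqrt hqp.le]
  rw [abs_mul, abs_inv, abs_of_pos (a := q ^ r) (by positivity)]
  calc |(piq F r : ℝ) - q ^ r / r| * (q ^ r)⁻¹ ≤ (√q) ^ r * (q ^ r)⁻¹ := by
        gcongr; exact h3.trans h4
    _ = ((√q)⁻¹) ^ r := by
        rw [h5, inv_pow]
        have : (√q) ^ r ≠ 0 := by positivity
        field_simp
    _ ≤ _ := by gcongr

lemma summable_ee : Summable (fun r : ℕ => (r : ℝ) ^ 2 * |ee F r|) := by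
  have h : ‖(√2)⁻¹‖ < 1 := by
    rw [Real.norm_of_nonneg (by positivity)]
    apply inv_lt_one_of_one_lt₀
    rw [Real.lt_sqrt] <;> norm_num
  refine Summable.of_nonneg_of_le (fun r => by positivity) (fun r => ?_)
    (summable_pow_mul_geometric_of_norm_lt_one 2 h)
  gcongr
  exact abs_ee_le F r

lemma piq_eq (r : ℕ) : (piq F r : ℝ) * ((Fintype.card F : ℝ) ^ r)⁻¹ = (r : ℝ)⁻¹ + ee F r := by
  unfold ee
  split_ifs with hr
  · simp [hr, piq_zero]
  have : (Fintype.card F : ℝ) ≠ 0 := by exact_mod_cast Fintype.card_ne_zero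
  have : (r : ℝ) ≠ 0 := by exact_mod_cast hr
  field_simp
  ring

end Count

section Analysis

/-- harmonic numbers -/
noncomputable def HH (n : ℕ) : ℝ := ∑ k ∈ Finset.range (n + 1), (k : ℝ)⁻¹

lemma HH_zero : HH 0 = 0 := by simp [HH]

lemma HH_succ (n : ℕ) : HH (n + 1) = HH n + ((n + 1 : ℕ) : ℝ)⁻¹ := by
  unfold HH; rw [Finset.sum_range_succ]

lemma HH_eq (n : ℕ) : HH n = (harmonic n : ℝ) := by
  unfold HH harmonic
  rw [Finset.sum_range_succ']
  push_cast
  simp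

lemma HH_bounds (n : ℕ) (hn : 1 ≤ n) :
    0 ≤ HH n - (Real.log n + Real.eulerMascheroniConstant) ∧
    HH n - (Real.log n + Real.eulerMascheroniConstant) ≤ 1 / n := by
  have h1 := Real.eulerMascheroniSeq_lt_eulerMascheroniConstant n
  have h2 := Real.eulerMascheroniConstant_lt_eulerMascheroniSeq' n
  have hn' : (0 : ℝ) < n := by exact_mod_cast hn
  unfold Real.eulerMascheroniSeq at h1
  unfold Real.eulerMascheroniSeq' at h2
  rw [if_neg (by omega)] at h2
  rw [← HH_eq] at h1 h2
  constructor
  · linarith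
  · have h3 : Real.log (n + 1) - Real.log n ≤ 1 / n := by
      rw [← Real.log_div (by positivity) (by positivity)]
      have := Real.log_le_sub_one_of_pos (x := ((n : ℝ) + 1) / n) (by positivity)
      have h4 : ((n : ℝ) + 1) / n - 1 = 1 / n := by field_simp; ring
      linarith
    linarith

lemma HH_conv (n : ℕ) : ∑ r ∈ Finset.range (n + 1), (r : ℝ)⁻¹ * HH (n - r) =
    HH n ^ 2 - ∑ k ∈ Finset.range (n + 1), ((k : ℝ) ^ 2)⁻¹ := by
  induction n with
  | zero => simp [HH_zero]
  | succ n ih =>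
    rw [Finset.sum_range_succ, Nat.sub_self, HH_zero, mul_zero, add_zero,
      Finset.sum_range_succ _ (n + 1)]
    have h1 : ∑ r ∈ Finset.range (n + 1), (r : ℝ)⁻¹ * HH (n + 1 - r) =
        ∑ r ∈ Finset.range (n + 1), (r : ℝ)⁻¹ * HH (n - r) +
        ∑ r ∈ Finset.range (n + 1), (r : ℝ)⁻¹ * ((n + 1 - r : ℕ) : ℝ)⁻¹ := by
      rw [← Finset.sum_add_distrib]
      refine Finset.sum_congr rfl fun r hr => ?_
      have hr' : r ≤ n := by simpa [Nat.lt_succ_iff] using hr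
      rw [Nat.succ_sub hr', Nat.succ_eq_add_one, HH_succ]
      ring
    have h2 : ∑ r ∈ Finset.range (n + 1), ((n + 1 - r : ℕ) : ℝ)⁻¹ = HH (n + 1) := by
      unfold HH
      rw [Finset.sum_range_succ' _ (n + 1), ← Finset.sum_range_reflect]
      simp only [Nat.cast_zero, inv_zero, add_zero]
      refine Finset.sum_congr rfl fun r hr => ?_
      have hr' : r ≤ n := by simpa [Nat.lt_succ_iff] using hr
      congr 2
      omega
    have h3 : ∑ r ∈ Finset.range (n + 1), (r : ℝ)⁻¹ * ((n + 1 - r : ℕ) : ℝ)⁻¹ =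
        (HH n + HH (n + 1)) * ((n + 1 : ℕ) : ℝ)⁻¹ - (((n + 1 : ℕ) : ℝ) ^ 2)⁻¹ := by
      have h4 : ∀ r ∈ Finset.range (n + 1), (r : ℝ)⁻¹ * ((n + 1 - r : ℕ) : ℝ)⁻¹ =
          ((r : ℝ)⁻¹ + ((n + 1 - r : ℕ) : ℝ)⁻¹) * ((n + 1 : ℕ) : ℝ)⁻¹ -
          if r = 0 then (((n + 1 : ℕ) : ℝ) ^ 2)⁻¹ else 0 := by
        intro r hr
        have hr' : r ≤ n := by simpa [Nat.lt_succ_iff] using hr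
        split_ifs with h0
        · subst h0
          simp only [Nat.cast_zero, inv_zero, zero_mul, zero_add, Nat.sub_zero]
          rw [pow_two, mul_inv, sub_self]
        · obtain ⟨m, rfl⟩ := Nat.exists_eq_add_of_le hr'
          have e : r + m + 1 - r = m + 1 := by omega
          rw [e]
          have : (r : ℝ) ≠ 0 := by exact_mod_cast h0
          push_cast
          field_simp
          ring
      rw [Finset.sum_congr rfl h4, Finset.sum_sub_distrib, ← Finset.sum_mul,
        Finset.sum_add_distrib, h2]
      simp [HH]
    rw [h1, ih, h3, HH_succ, pow_two (((n + 1 : ℕ) : ℝ)), mul_inv]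
    ring

lemma zeta_tail (n : ℕ) (hn : 1 ≤ n) :
    0 ≤ Real.pi ^ 2 / 6 - ∑ k ∈ Finset.range (n + 1), ((k : ℝ) ^ 2)⁻¹ ∧
    Real.pi ^ 2 / 6 - ∑ k ∈ Finset.range (n + 1), ((k : ℝ) ^ 2)⁻¹ ≤ 2 / n := by
  have hs : HasSum (fun k : ℕ => ((k : ℝ) ^ 2)⁻¹) (Real.pi ^ 2 / 6) := by
    simpa using hasSum_zeta_two
  have hn' : (0 : ℝ) < n := by exact_mod_cast hn
  constructor
  · rw [← hs.tsum_eq]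
    have := hs.summable.sum_le_tsum (Finset.range (n + 1)) (fun _ _ => by positivity)
    linarith
  · rw [← hs.tsum_eq, ← hs.summable.sum_add_tsum_nat_add (n + 1), add_sub_cancel_left]
    refine Real.tsum_le_of_sum_range_le (fun _ => by positivity) fun m => ?_
    have h1 := sum_Ioo_inv_sq_le (α := ℝ) n (n + 1 + m)
    have h2 : ∑ i ∈ Finset.range m, (((i + (n + 1) : ℕ) : ℝ) ^ 2)⁻¹ =
        ∑ i ∈ Finset.Ioo n (n + 1 + m), ((i : ℝ) ^ 2)⁻¹ := by
      have : Finset.Ioo n (n + 1 + m) = Finset.Ico (n + 1) (n + 1 + m) := by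
        ext; simp
      rw [this, Finset.sum_Ico_eq_sum_range]
      simp [add_comm]
    rw [h2]
    refine h1.trans ?_
    gcongr
    linarith

lemma HH_nonneg (n : ℕ) : 0 ≤ HH n := Finset.sum_nonneg fun _ _ => by positivity

lemma HH_le (n : ℕ) : HH n ≤ n := by
  induction n with
  | zero => simp [HH_zero]
  | succ n ih =>
    rw [HH_succ]
    have : ((n + 1 : ℕ) : ℝ)⁻¹ ≤ 1 := by
      apply inv_le_one_of_one_le₀; exact_mod_cast Nat.le_add_left 1 n
    push_cast at this ⊢
    linarith

lemma inv_sub_le (n r : ℕ) (hn : 1 ≤ n) (hr : 1 ≤ r) :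
    1 / ((n - r : ℕ) + 1 : ℝ) ≤ r / n := by
  have hn' : (0 : ℝ) < n := by exact_mod_cast hn
  rw [div_le_div_iff₀ (by positivity) hn', one_mul]
  rcases le_total r n with h | h
  · obtain ⟨m, rfl⟩ := Nat.exists_eq_add_of_le h
    rw [Nat.add_sub_cancel_left]
    have : (1 : ℝ) ≤ r := by exact_mod_cast hr
    have hm : (0 : ℝ) ≤ m := by positivity
    push_cast
    nlinarith
  · rw [Nat.sub_eq_zero_of_le h]
    have : (n : ℝ) ≤ r := by exact_mod_cast h
    push_cast
    linarith

lemma HH_diff (n r : ℕ) (hn : 1 ≤ n) (hr : 1 ≤ r) :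
    |HH (n - r) - HH n| ≤ (r : ℝ) ^ 2 / n := by
  have hn' : (0 : ℝ) < n := by exact_mod_cast hn
  rcases le_total r n with h | h
  · obtain ⟨m, rfl⟩ := Nat.exists_eq_add_of_le' h
    have hk := inv_sub_le (m + r) r hn hr
    rw [Nat.add_sub_cancel] at hk ⊢
    have e : HH (m + r) = HH m + ∑ i ∈ Finset.range r, ((m + 1 + i : ℕ) : ℝ)⁻¹ := by
      unfold HH
      rw [← Finset.sum_range_add, show m + r + 1 = m + 1 + r by ring]
    rw [e, sub_add_cancel_left, abs_neg, abs_of_nonneg (Finset.sum_nonneg fun _ _ => by positivity)]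
    calc ∑ i ∈ Finset.range r, ((m + 1 + i : ℕ) : ℝ)⁻¹
        ≤ ∑ i ∈ Finset.range r, (r : ℝ) / (m + r : ℕ) := by
          refine Finset.sum_le_sum fun i _ => le_trans ?_ hk
          rw [one_div]
          apply inv_anti₀ (by positivity)
          push_cast
          have : (0 : ℝ) ≤ i := by positivity
          linarith
      _ = _ := by
          rw [Finset.sum_const, Finset.card_range, nsmul_eq_mul]; ring
  · rw [Nat.sub_eq_zero_of_le h, HH_zero, zero_sub, abs_neg, abs_of_nonneg (HH_nonneg n),
      le_div_iff₀ hn']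
    have h1 := HH_le n
    have h2 : (n : ℝ) ≤ r := by exact_mod_cast h
    nlinarith

lemma summable_of_sq {f : ℕ → ℝ} (h0 : f 0 = 0)
    (hf : Summable (fun r : ℕ => (r : ℝ) ^ 2 * |f r|)) : Summable (fun r => |f r|) := by
  refine Summable.of_nonneg_of_le (fun r => abs_nonneg _) (fun r => ?_) hf
  rcases Nat.eq_zero_or_pos r with rfl | hr
  · simp [h0]
  · have : (1 : ℝ) ≤ r := by exact_mod_cast hr
    have h2 : (1 : ℝ) ≤ (r : ℝ) ^ 2 := one_le_pow₀ this
    nlinarith [abs_nonneg (f r)]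

lemma conv_bound {f G : ℕ → ℝ} (h0 : f 0 = 0)
    (hf : Summable (fun r : ℕ => (r : ℝ) ^ 2 * |f r|)) (hG : G 0 = 0) (n : ℕ) (L C : ℝ)
    (hGL : ∀ r, 1 ≤ r → |G (n - r) - L| ≤ C * ((r : ℝ) ^ 2 / n)) :
    |∑ r ∈ Finset.range (n + 1), f r * G (n - r) - (∑' r, f r) * L| ≤
      C * (∑' r : ℕ, (r : ℝ) ^ 2 * |f r|) / n := by
  have hs := summable_of_sq h0 hf
  have hs' : Summable f := hs.of_abs
  have hz : ∀ r ∉ Finset.range (n + 1), f r * G (n - r) = 0 := by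
    intro r hr
    rw [Finset.mem_range, not_lt] at hr
    rw [Nat.sub_eq_zero_of_le (by omega), hG, mul_zero]
  have hsum : Summable (fun r => f r * G (n - r)) := summable_of_ne_finset_zero hz
  rw [← tsum_eq_sum (L := SummationFilter.unconditional ℕ) hz, ← tsum_mul_right, ← hsum.tsum_sub (hs'.mul_right L)]
  have hb : ∀ r : ℕ, ‖f r * G (n - r) - f r * L‖ ≤ C / n * ((r : ℝ) ^ 2 * |f r|) := by
    intro r
    rcases Nat.eq_zero_or_pos r with rfl | hr
    · simp [h0]
    · rw [← mul_sub, Real.norm_eq_abs, abs_mul]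
      calc |f r| * |G (n - r) - L| ≤ |f r| * (C * ((r : ℝ) ^ 2 / n)) := by
            gcongr; exact hGL r hr
        _ = _ := by ring
  rw [← Real.norm_eq_abs]
  refine (tsum_of_norm_bounded (hf.mul_left (C / n)).hasSum hb).trans_eq ?_
  rw [tsum_mul_left]; ring

lemma partial_bound {f : ℕ → ℝ} (h0 : f 0 = 0)
    (hf : Summable (fun r : ℕ => (r : ℝ) ^ 2 * |f r|)) (m : ℕ) :
    |∑ r ∈ Finset.range (m + 1), f r - ∑' r, f r| ≤
      (∑' r : ℕ, (r : ℝ) ^ 2 * |f r|) * (1 / (m + 1 : ℝ)) := by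
  have hs := summable_of_sq h0 hf
  have hs' : Summable f := hs.of_abs
  rw [← hs'.sum_add_tsum_nat_add (m + 1), sub_add_cancel_left, abs_neg, ← Real.norm_eq_abs]
  have hf' := (summable_nat_add_iff (m + 1)).2 hf
  have hb : ∀ r : ℕ, ‖f (r + (m + 1))‖ ≤
      (1 / (m + 1 : ℝ)) * (((r + (m + 1) : ℕ) : ℝ) ^ 2 * |f (r + (m + 1))|) := by
    intro r
    rw [Real.norm_eq_abs, ← mul_assoc]
    apply le_mul_of_one_le_left (abs_nonneg _)
    rw [one_div, ← div_eq_inv_mul, le_div_iff₀ (by positivity), one_mul]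
    push_cast
    have h1 : (0 : ℝ) ≤ r := by positivity
    have h2 : (0 : ℝ) ≤ m := by positivity
    nlinarith
  refine (tsum_of_norm_bounded (hf'.mul_left _).hasSum hb).trans ?_
  rw [tsum_mul_left, mul_comm]
  refine mul_le_mul_of_nonneg_right ?_ (by positivity)
  rw [← hf.sum_add_tsum_nat_add (m + 1)]
  have : 0 ≤ ∑ i ∈ Finset.range (m + 1), (i : ℝ) ^ 2 * |f i| :=
    Finset.sum_nonneg fun _ _ => by positivity
  linarith

lemma conv_comm (f g : ℕ → ℝ) (n : ℕ) :
    ∑ r ∈ Finset.range (n + 1), f r * ∑ s ∈ Finset.range (n - r + 1), g s =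
    ∑ r ∈ Finset.range (n + 1), g r * ∑ s ∈ Finset.range (n - r + 1), f s := by
  simp only [Finset.mul_sum]
  rw [Finset.sum_comm' (t' := Finset.range (n + 1)) (s' := fun s => Finset.range (n - s + 1))]
  · exact Finset.sum_congr rfl fun _ _ => Finset.sum_congr rfl fun _ _ => mul_comm _ _
  · intro x y
    simp only [Finset.mem_range]
    omega

lemma main_conv {f : ℕ → ℝ} (h0 : f 0 = 0)
    (hf : Summable (fun r : ℕ => (r : ℝ) ^ 2 * |f r|)) : ∃ C : ℝ, ∀ n : ℕ, 1 ≤ n →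
    |∑ r ∈ Finset.range (n + 1), ((r : ℝ)⁻¹ + f r) *
        ∑ s ∈ Finset.range (n - r + 1), ((s : ℝ)⁻¹ + f s) -
      ((HH n + ∑' r, f r) ^ 2 - ∑ k ∈ Finset.range (n + 1), ((k : ℝ) ^ 2)⁻¹)| ≤ C / n := by
  set K := ∑' r : ℕ, (r : ℝ) ^ 2 * |f r| with hK
  have hK0 : 0 ≤ K := tsum_nonneg fun _ => by positivity
  refine ⟨2 * K + K * K, fun n hn => ?_⟩
  have hn' : (0 : ℝ) < n := by exact_mod_cast hn
  have e1 := HH_conv n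
  have e2 := conv_bound h0 hf HH_zero n (HH n) 1
    (fun r hr => by rw [one_mul]; exact HH_diff n r hn hr)
  have e3 := conv_bound (G := fun m => ∑ s ∈ Finset.range (m + 1), f s) h0 hf (by simp [h0]) n
    (∑' r, f r) K (fun r hr => by
      refine (partial_bound h0 hf (n - r)).trans ?_
      refine mul_le_mul_of_nonneg_left ?_ hK0
      refine (inv_sub_le n r hn hr).trans ?_
      gcongr
      have : (1 : ℝ) ≤ r := by exact_mod_cast hr
      nlinarith)
  have e4 := conv_comm (fun r => (r : ℝ)⁻¹) f n
  have e5 : ∑ r ∈ Finset.range (n + 1), ((r : ℝ)⁻¹ + f r) *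
        ∑ s ∈ Finset.range (n - r + 1), ((s : ℝ)⁻¹ + f s) =
      ∑ r ∈ Finset.range (n + 1), (r : ℝ)⁻¹ * HH (n - r) +
      2 * ∑ r ∈ Finset.range (n + 1), f r * HH (n - r) +
      ∑ r ∈ Finset.range (n + 1), f r * ∑ s ∈ Finset.range (n - r + 1), f s := by
    rw [two_mul]
    nth_rewrite 2 [show ∑ r ∈ Finset.range (n + 1), f r * HH (n - r) = _ from e4.symm]
    simp only [← Finset.sum_add_distrib]
    refine Finset.sum_congr rfl fun r _ => ?_
    rw [Finset.sum_add_distrib]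
    unfold HH
    ring
  rw [e5, e1]
  rw [← hK] at e2 e3
  rw [abs_le] at e2 e3 ⊢
  have e6 : (2 * K + K * K) / n = 2 * (1 * K / n) + K * K / n := by ring
  rw [e6]
  constructor <;> nlinarith

end Analysis

section Sums
variable (F : Type*) [Field F] [Fintype F]

open Classical in
/-- monic irreducibles of degree at most `n` -/
noncomputable def II (n : ℕ) : Finset F[X] := (Finset.range (n + 1)).biUnion (JJ F)

lemma mem_II {n : ℕ} {l : F[X]} :
    l ∈ II F n ↔ l.Monic ∧ Irreducible l ∧ l.natDegree ≤ n := by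
  classical
  unfold II
  rw [Finset.mem_biUnion]
  constructor
  · rintro ⟨r, hr, hl⟩
    have := (mem_JJ F).1 hl
    rw [Finset.mem_range] at hr
    exact ⟨this.1, this.2.1, by omega⟩
  · rintro ⟨a, b, c⟩
    exact ⟨l.natDegree, Finset.mem_range.2 (by omega), (mem_JJ F).2 ⟨a, b, rfl⟩⟩

lemma sum_II (n : ℕ) (g : ℕ → ℝ) :
    ∑ l ∈ II F n, g l.natDegree = ∑ r ∈ Finset.range (n + 1), (piq F r : ℝ) * g r := by
  classical
  unfold II
  rw [Finset.sum_biUnion]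
  · refine Finset.sum_congr rfl fun r _ => ?_
    rw [card_JJ, ← nsmul_eq_mul, ← Finset.sum_const]
    exact Finset.sum_congr rfl fun l hl => by rw [((mem_JJ F).1 hl).2.2]
  · intro r _ s _ hrs
    rw [Function.onFun, Finset.disjoint_left]
    intro l h1 h2
    exact hrs (((mem_JJ F).1 h1).2.2.symm.trans ((mem_JJ F).1 h2).2.2)

/-- `1/|l|` -/
noncomputable def ww (l : F[X]) : ℝ := ((Fintype.card F : ℝ) ^ l.natDegree)⁻¹

lemma S1_eq (n : ℕ) :
    (∑ᶠ p ∈ {p : Polynomial F × Polynomial F |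
            p.1.Monic ∧ Irreducible p.1 ∧ p.2.Monic ∧ Irreducible p.2 ∧ p.1 ≠ p.2 ∧
            p.1.natDegree + p.2.natDegree ≤ n},
          ((Fintype.card F : ℝ) ^ p.1.natDegree)⁻¹ *
            ((Fintype.card F : ℝ) ^ p.2.natDegree)⁻¹) =
    ∑ r ∈ Finset.range (n + 1), ((r : ℝ)⁻¹ + ee F r) *
        ∑ s ∈ Finset.range (n - r + 1), ((s : ℝ)⁻¹ + ee F s) -
    ∑ l ∈ II F (n / 2), ww F l ^ 2 := by
  classical
  set A : Finset (F[X] × F[X]) := (II F n ×ˢ II F n).filter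
    (fun p => p.1.natDegree + p.2.natDegree ≤ n) with hA
  have hset : {p : Polynomial F × Polynomial F |
            p.1.Monic ∧ Irreducible p.1 ∧ p.2.Monic ∧ Irreducible p.2 ∧ p.1 ≠ p.2 ∧
            p.1.natDegree + p.2.natDegree ≤ n} = ↑(A.filter (fun p => ¬ p.1 = p.2)) := by
    ext p
    simp only [Set.mem_ofPred_eq, Finset.coe_filter, hA, Finset.mem_filter, Finset.mem_product,
      mem_II]
    constructor
    · rintro ⟨a, b, c, d, e, f⟩
      exact ⟨⟨⟨⟨a, b, by omega⟩, ⟨c, d, by omega⟩⟩, f⟩, e⟩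
    · rintro ⟨⟨⟨⟨a, b, -⟩, ⟨c, d, -⟩⟩, f⟩, e⟩
      exact ⟨a, b, c, d, e, f⟩
  rw [hset, finsum_mem_coe_finset]
  have h1 := Finset.sum_filter_add_sum_filter_not A (fun p => p.1 = p.2)
    (fun p => ww F p.1 * ww F p.2)
  have h2 : ∑ p ∈ A, ww F p.1 * ww F p.2 =
      ∑ r ∈ Finset.range (n + 1), ((r : ℝ)⁻¹ + ee F r) *
        ∑ s ∈ Finset.range (n - r + 1), ((s : ℝ)⁻¹ + ee F s) := by
    have h3 : ∀ l ∈ II F n, ∑ h ∈ II F n,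
        (if l.natDegree + h.natDegree ≤ n then ww F l * ww F h else 0) =
        (fun r => ((Fintype.card F : ℝ) ^ r)⁻¹ *
          ∑ s ∈ Finset.range (n - r + 1), ((s : ℝ)⁻¹ + ee F s)) l.natDegree := by
      intro l hl
      have hl' := ((mem_II F).1 hl).2.2
      rw [← Finset.sum_filter, ← Finset.mul_sum]
      have : (II F n).filter (fun h => l.natDegree + h.natDegree ≤ n) =
          II F (n - l.natDegree) := by
        ext h
        rw [Finset.mem_filter, mem_II, mem_II]
        constructor
        · rintro ⟨⟨a, b, c⟩, d⟩; exact ⟨a, b, by omega⟩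
        · rintro ⟨a, b, c⟩; exact ⟨⟨a, b, by omega⟩, by omega⟩
      rw [this]
      have h4 := sum_II F (n - l.natDegree) (fun r => ((Fintype.card F : ℝ) ^ r)⁻¹)
      simp only [piq_eq] at h4
      simp only [ww]
      rw [h4]
    rw [hA, Finset.sum_filter, Finset.sum_product, Finset.sum_congr rfl h3,
      sum_II F n (fun r => ((Fintype.card F : ℝ) ^ r)⁻¹ *
          ∑ s ∈ Finset.range (n - r + 1), ((s : ℝ)⁻¹ + ee F s))]
    refine Finset.sum_congr rfl fun r _ => ?_
    rw [← mul_assoc, piq_eq]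
  have h5 : ∑ p ∈ A.filter (fun p => p.1 = p.2), ww F p.1 * ww F p.2 =
      ∑ l ∈ II F (n / 2), ww F l ^ 2 := by
    refine Finset.sum_bij' (fun p _ => p.1) (fun l _ => (l, l)) ?_ ?_ ?_ ?_ ?_
    · rintro ⟨l, h⟩ hp
      simp only [hA, Finset.mem_filter, Finset.mem_product, mem_II] at hp ⊢
      obtain ⟨⟨⟨⟨a, b, c⟩, -⟩, d⟩, rfl⟩ := hp
      exact ⟨a, b, by omega⟩
    · intro l hl
      simp only [hA, Finset.mem_filter, Finset.mem_product, mem_II] at hl ⊢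
      obtain ⟨a, b, c⟩ := hl
      exact ⟨⟨⟨⟨a, b, by omega⟩, ⟨a, b, by omega⟩⟩, by omega⟩, trivial⟩
    · rintro ⟨l, h⟩ hp
      rw [Finset.mem_filter] at hp
      have := hp.2
      simp only at this
      rw [this]
    · intro l _; rfl
    · rintro ⟨l, h⟩ hp
      rw [Finset.mem_filter] at hp
      have := hp.2
      simp only at this
      simp only [this]
      ring
  rw [h2, h5] at h1
  simp only [ww] at h1 ⊢
  linarith

lemma sum_deg_le (t : Finset F[X]) (ht : ∀ l ∈ t, l.Monic ∧ Irreducible l) :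
    ∑ l ∈ t, (l.natDegree : ℝ) * ww F l ^ 2 ≤ 2 := by
  classical
  have hsub : t ⊆ II F (t.sup natDegree) := fun l hl =>
    (mem_II F).2 ⟨(ht l hl).1, (ht l hl).2, Finset.le_sup (f := natDegree) hl⟩
  refine (Finset.sum_le_sum_of_subset_of_nonneg hsub fun _ _ _ => by
    unfold ww; positivity).trans ?_
  have h1 := sum_II F (t.sup natDegree)
    (fun r => (r : ℝ) * (((Fintype.card F : ℝ) ^ r)⁻¹) ^ 2)
  simp only [ww]
  rw [h1]
  have hq : (2 : ℝ) ≤ Fintype.card F := by exact_mod_cast (Fintype.one_lt_card (α := F))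
  calc _ ≤ ∑ r ∈ Finset.range (t.sup natDegree + 1), ((1 : ℝ) / 2) ^ r := by
        refine Finset.sum_le_sum fun r _ => ?_
        have h2 : (r : ℝ) * piq F r ≤ (Fintype.card F : ℝ) ^ r := by exact_mod_cast piq_upper F r
        have h3 : (0 : ℝ) < (Fintype.card F : ℝ) ^ r := by positivity
        calc (piq F r : ℝ) * (r * (((Fintype.card F : ℝ) ^ r)⁻¹) ^ 2)
            = (r * piq F r) * (((Fintype.card F : ℝ) ^ r)⁻¹) ^ 2 := by ring
          _ ≤ (Fintype.card F : ℝ) ^ r * (((Fintype.card F : ℝ) ^ r)⁻¹) ^ 2 := by gcongr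
          _ = ((Fintype.card F : ℝ)⁻¹) ^ r := by rw [pow_two, mul_inv_cancel_left₀ h3.ne', inv_pow]
          _ ≤ _ := by rw [one_div]; gcongr
    _ ≤ ∑' r : ℕ, ((1 : ℝ) / 2) ^ r :=
        summable_geometric_two.sum_le_tsum _ (fun _ _ => by positivity)
    _ = 2 := tsum_geometric_two

lemma diag_bound (n : ℕ) (hn : 1 ≤ n) :
    |Lc F 2 - ∑ l ∈ II F (n / 2), ww F l ^ 2| ≤ 4 / n := by
  classical
  have hn' : (0 : ℝ) < n := by exact_mod_cast hn
  have hL : Lc F 2 = ∑' l : {l : Polynomial F // l.Monic ∧ Irreducible l}, ww F l ^ 2 := by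
    unfold Lc ww
    simp only [inv_pow]
  have hb : ∀ t : Finset {l : Polynomial F // l.Monic ∧ Irreducible l},
      ∑ l ∈ t, ((l : F[X]).natDegree : ℝ) * ww F l ^ 2 ≤ 2 := by
    intro t
    have := sum_deg_le F (t.map (Function.Embedding.subtype _)) (by
      intro l hl
      obtain ⟨x, -, rfl⟩ := Finset.mem_map.1 hl
      exact x.2)
    rwa [Finset.sum_map] at this
  have hsm : Summable (fun l : {l : Polynomial F // l.Monic ∧ Irreducible l} => ww F l ^ 2) := by
    refine summable_of_sum_le (c := 2) (fun _ => by positivity) fun t => le_trans ?_ (hb t)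
    refine Finset.sum_le_sum fun l _ => le_mul_of_one_le_left (by positivity) ?_
    exact_mod_cast l.2.2.natDegree_pos
  set s : Finset {l : Polynomial F // l.Monic ∧ Irreducible l} :=
    (II F (n / 2)).subtype _ with hs
  have hd : ∑ l ∈ II F (n / 2), ww F l ^ 2 = ∑ l ∈ s, ww F l ^ 2 := by
    rw [hs, Finset.sum_subtype_of_mem (fun l => ww F l ^ 2)]
    intro l hl
    have := (mem_II F).1 hl
    exact ⟨this.1, this.2.1⟩
  rw [hL, hd, abs_of_nonneg (sub_nonneg.2 (hsm.sum_le_tsum s (fun _ _ => by positivity))),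
    sub_le_iff_le_add']
  refine hsm.tsum_le_of_sum_le fun t => ?_
  rw [← Finset.sum_filter_add_sum_filter_not t (fun l => l ∈ s)]
  refine add_le_add ?_ ?_
  · refine Finset.sum_le_sum_of_subset_of_nonneg ?_ (fun _ _ _ => by positivity)
    intro l hl
    exact (Finset.mem_filter.1 hl).2
  · calc ∑ l ∈ t.filter (fun l => ¬ l ∈ s), ww F l ^ 2
        ≤ ∑ l ∈ t.filter (fun l => ¬ l ∈ s),
            2 / n * (((l : F[X]).natDegree : ℝ) * ww F l ^ 2) := by
          refine Finset.sum_le_sum fun l hl => ?_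
          rw [← mul_assoc]
          refine le_mul_of_one_le_left (by positivity) ?_
          have h1 := (Finset.mem_filter.1 hl).2
          rw [hs, Finset.mem_subtype, mem_II] at h1
          have h2 : n ≤ 2 * (l : F[X]).natDegree := by
            by_contra h
            exact h1 ⟨l.2.1, l.2.2, by omega⟩
          have h3 : (n : ℝ) ≤ 2 * (l : F[X]).natDegree := by exact_mod_cast h2
          rw [div_mul_eq_mul_div, le_div_iff₀ hn']
          linarith
      _ ≤ 2 / n * 2 := by
          rw [← Finset.mul_sum]
          gcongr
          exact hb _
      _ = 4 / n := by ring

end Sums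

/-- S₁(n): sum over distinct monic irreducibles l ≠ h with deg(lh) ≤ n of 1/(|l||h|). -/
theorem S1_asymptotic (F : Type*) [Field F] [Fintype F] :
    (fun n : ℕ =>
        (∑ᶠ p ∈ {p : Polynomial F × Polynomial F |
            p.1.Monic ∧ Irreducible p.1 ∧ p.2.Monic ∧ Irreducible p.2 ∧ p.1 ≠ p.2 ∧
            p.1.natDegree + p.2.natDegree ≤ n},
          ((Fintype.card F : ℝ) ^ p.1.natDegree)⁻¹ *
            ((Fintype.card F : ℝ) ^ p.2.natDegree)⁻¹) -
          ((Real.log n) ^ 2 + 2 * A1 F * Real.log n + (A1 F) ^ 2 -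
            Real.pi ^ 2 / 6 - Lc F 2))
      =O[atTop] (fun n : ℕ => Real.log n / n) := by
  simp only [S1_eq]
  obtain ⟨C, hC⟩ := main_conv (f := ee F) (by simp [ee]) (summable_ee F)
  have hA : A1 F = Real.eulerMascheroniConstant + ∑' r, ee F r := rfl
  set E := ∑' r, ee F r with hE
  refine IsBigO.of_bound (|C| + 2 + 4 + 2 + 2 * |A1 F| + 1) ?_
  have hlog : ∀ᶠ n : ℕ in atTop, (1 : ℝ) ≤ Real.log n :=
    (Real.tendsto_log_atTop.comp tendsto_natCast_atTop_atTop).eventually_ge_atTop 1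
  filter_upwards [hlog, eventually_ge_atTop 1] with n hl hn
  have hn' : (0 : ℝ) < n := by exact_mod_cast hn
  have hn1 : (1 : ℝ) ≤ n := by exact_mod_cast hn
  rw [Real.norm_eq_abs, Real.norm_eq_abs, abs_of_nonneg (a := Real.log n / n) (by positivity)]
  have b1 := hC n hn
  obtain ⟨b2, b3⟩ := HH_bounds n hn
  obtain ⟨b4, b5⟩ := zeta_tail n hn
  have b6 := diag_bound F n hn
  set D := ∑ r ∈ Finset.range (n + 1), ((r : ℝ)⁻¹ + ee F r) *
        ∑ s ∈ Finset.range (n - r + 1), ((s : ℝ)⁻¹ + ee F s)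
  set Z := ∑ k ∈ Finset.range (n + 1), ((k : ℝ) ^ 2)⁻¹
  set W := ∑ l ∈ II F (n / 2), ww F l ^ 2
  set δ := HH n - (Real.log n + Real.eulerMascheroniConstant) with hδ
  have e1 : HH n + E = Real.log n + A1 F + δ := by rw [hδ, hA]; ring
  rw [e1] at b1
  set x := Real.log n
  set a := A1 F
  have e2 : D - W - (x ^ 2 + 2 * a * x + a ^ 2 - Real.pi ^ 2 / 6 - Lc F 2) =
      (D - ((x + a + δ) ^ 2 - Z)) + (Real.pi ^ 2 / 6 - Z) + (Lc F 2 - W) +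
      (2 * δ * x + 2 * δ * a + δ * δ) := by ring
  rw [e2]
  have c1 : |D - ((x + a + δ) ^ 2 - Z)| ≤ |C| * (x / n) := by
    refine b1.trans ?_
    rw [← mul_div_assoc]
    gcongr
    nlinarith [le_abs_self C, abs_nonneg C]
  have hxn : 1 / (n : ℝ) ≤ x / n := by gcongr
  have c2 : |Real.pi ^ 2 / 6 - Z| ≤ 2 * (x / n) := by
    rw [abs_of_nonneg b4]
    have : 2 / (n : ℝ) = 2 * (1 / n) := by ring
    linarith
  have c3 : |Lc F 2 - W| ≤ 4 * (x / n) := by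
    have : 4 / (n : ℝ) = 4 * (1 / n) := by ring
    linarith
  have hδ1 : δ ≤ 1 := b3.trans (by rw [div_le_one hn']; exact hn1)
  have c4 : |2 * δ * x| ≤ 2 * (x / n) := by
    rw [abs_of_nonneg (by positivity)]
    have : x / n = 1 / n * x := by ring
    rw [this]
    nlinarith
  have c5 : |2 * δ * a| ≤ 2 * |a| * (x / n) := by
    rw [abs_mul, abs_of_nonneg (a := 2 * δ) (by positivity)]
    have : δ ≤ x / n := b3.trans hxn
    nlinarith [abs_nonneg a]
  have c6 : |δ * δ| ≤ 1 * (x / n) := by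
    rw [abs_of_nonneg (by positivity)]
    have : δ ≤ x / n := b3.trans hxn
    nlinarith
  have t1 := abs_add_le (D - ((x + a + δ) ^ 2 - Z) + (Real.pi ^ 2 / 6 - Z) + (Lc F 2 - W))
    (2 * δ * x + 2 * δ * a + δ * δ)
  have t2 := abs_add_le (D - ((x + a + δ) ^ 2 - Z) + (Real.pi ^ 2 / 6 - Z)) (Lc F 2 - W)
  have t3 := abs_add_le (D - ((x + a + δ) ^ 2 - Z)) (Real.pi ^ 2 / 6 - Z)
  have t4 := abs_add_le (2 * δ * x + 2 * δ * a) (δ * δ)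
  have t5 := abs_add_le (2 * δ * x) (2 * δ * a)
  linarith
end
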